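/- Let Ψ be a flow on a compact manifold M preserving a probability measure ν, and f: M → ℝ^N a measurable observation with escape function ρ. Then for ν-almost every x ∈ M, liminf_{r→0} [log τ_{r,ρ}^{Ψ,f}(x) / (−log r)] ≤ liminf_{r→0} [ log(f_*ν(B(f(x),r)))/log r − log ρ_r(f(x))/log r ], and the analogous inequality holds with limsup in place of liminf. -/

import Mathlib

open MeasureTheory Filter Metric Topology

/-- The escape-function property: for all `0 < ξ₁ < 1`, `ξ₂ > 1`, `ε > 0`, for `m`-a.e. `z₁`
there is `ζ > 0` such that for `r < ζ` and `m`-a.e.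
`z₂ ∈ B(z₁, min{(1−ξ₁)r, (ξ₂−1)r})`, `r^ε ρ_{ξ₁ r}(z₂) ≤ ρ_r(z₁) ≤ ρ_{ξ₂ r}(z₂) r^{−ε}`. -/
def IsEscapeFunction {N : ℕ} (m : Measure (EuclideanSpace ℝ (Fin N)))
    (ρ : ℝ → EuclideanSpace ℝ (Fin N) → ℝ) : Prop :=
  ∀ ξ₁ : ℝ, 0 < ξ₁ → ξ₁ < 1 → ∀ ξ₂ : ℝ, 1 < ξ₂ → ∀ ε : ℝ, 0 < ε →
    ∀ᵐ z₁ ∂m, ∃ ζ > (0 : ℝ), ∀ r : ℝ, 0 < r → r < ζ →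
      ∀ᵐ z₂ ∂m, z₂ ∈ ball z₁ (min ((1 - ξ₁) * r) ((ξ₂ - 1) * r)) →
        r ^ ε * ρ (ξ₁ * r) z₂ ≤ ρ r z₁ ∧ ρ r z₁ ≤ ρ (ξ₂ * r) z₂ * r ^ (-ε)

/-- The return time for the observation `f` of the flow `Ψ` with respect to the escape
function `ρ`: `τ_{r,ρ}^{Ψ,f}(x) = inf {t > ρ_r(f x) : f(Ψ_t x) ∈ B(f x, r)}`. -/
noncomputable def obsReturnTime {M : Type*} [MetricSpace M] {N : ℕ}
    (Ψ : ℝ → M → M) (f : M → EuclideanSpace ℝ (Fin N))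
    (ρ : ℝ → EuclideanSpace ℝ (Fin N) → ℝ) (r : ℝ) (x : M) : ℝ :=
  sInf {t : ℝ | ρ r (f x) < t ∧ f (Ψ t x) ∈ ball (f x) r}

/-- The lower recurrence rate for the observation of the flow with respect to `ρ`. -/
noncomputable def lowerObsRate {M : Type*} [MetricSpace M] {N : ℕ}
    (Ψ : ℝ → M → M) (f : M → EuclideanSpace ℝ (Fin N))
    (ρ : ℝ → EuclideanSpace ℝ (Fin N) → ℝ) (x : M) : ℝ :=
  liminf (fun r : ℝ => Real.log (obsReturnTime Ψ f ρ r x) / (-Real.log r)) (𝓝[>] 0)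


theorem liminf_le_and_limsup_le_of_eventually {α : Type*} {l : Filter α} [l.NeBot] {u v : α → ℝ}
    (hU : ∀ A ε : ℝ, 0 < ε → ∀ᶠ r in l, v r ≤ A → u r ≤ max (v r) (-A) + ε)
    (hL : ∃ c : ℝ, ∀ C : ℝ, ∀ᶠ r in l, -C ≤ v r → min (v r) C - c ≤ u r) :
    liminf u l ≤ liminf v l ∧ limsup u l ≤ limsup v l := by
  obtain ⟨c, hL⟩ := hL
  rw [liminf_eq, liminf_eq, limsup_eq, limsup_eq]
  constructor
  · by_cases hne : {a | ∀ᶠ r in l, a ≤ v r}.Nonempty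
    · obtain ⟨b, hb⟩ := hne
      by_cases hbdd : BddAbove {a | ∀ᶠ r in l, a ≤ v r}
      · refine le_of_forall_pos_le_add fun ε hε => ?_
        have hune : {a | ∀ᶠ r in l, a ≤ u r}.Nonempty := by
          refine ⟨min b |b| - c, ?_⟩
          filter_upwards [hL |b|, hb] with r h1 h2
          exact (sub_le_sub_right (min_le_min_right _ h2) c).trans
            (h1 ((neg_abs_le b).trans h2))
        refine csSup_le hune fun a ha => ?_
        set S := sSup {a | ∀ᶠ r in l, a ≤ v r}
        have hS : ¬ ∀ᶠ r in l, S + ε / 2 ≤ v r := fun h => by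
          have := le_csSup hbdd h
          linarith
        obtain ⟨r, hr, h1, h2⟩ := ((not_eventually.1 hS).and_eventually
          ((show ∀ᶠ r in l, a ≤ u r from ha).and
            (hU (|S + ε / 2|) (ε / 2) (half_pos hε)))).exists
        rw [not_le] at hr
        have h3 := h2 (hr.le.trans (le_abs_self _))
        have h4 : max (v r) (-|S + ε / 2|) ≤ S + ε / 2 := max_le hr.le (neg_abs_le _)
        linarith
      · rw [Real.sSup_of_not_bddAbove hbdd, Real.sSup_of_not_bddAbove]
        intro ⟨B, hB⟩
        refine hbdd ⟨max 0 (B + c), fun a ha => ?_⟩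
        by_contra! hlt
        obtain ⟨h0, h1⟩ := max_lt_iff.1 hlt
        have : a - c ∈ {a | ∀ᶠ r in l, a ≤ u r} := by
          filter_upwards [hL a, show ∀ᶠ r in l, a ≤ v r from ha] with r h2 h3
          have := h2 (by linarith)
          rwa [min_eq_right h3] at this
        have := hB this
        linarith
    · rw [Set.not_nonempty_iff_eq_empty.1 hne]
      rw [Set.eq_empty_of_forall_notMem (s := {a | ∀ᶠ r in l, a ≤ u r})]
      intro a ha
      apply hne
      refine ⟨-(|a| + 2), ?_⟩
      filter_upwards [hU (|a| + 2) 1 one_pos, show ∀ᶠ r in l, a ≤ u r from ha] with r h1 h2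
      by_contra! h3
      have h4 := h1 (by linarith [abs_nonneg a])
      rw [max_eq_right h3.le] at h4
      linarith [neg_abs_le a]
  · by_cases hne : {a | ∀ᶠ r in l, v r ≤ a}.Nonempty
    · obtain ⟨b, hb⟩ := hne
      by_cases hbdd : BddBelow {a | ∀ᶠ r in l, v r ≤ a}
      · have hubdd : BddBelow {a | ∀ᶠ r in l, u r ≤ a} := by
          obtain ⟨B, hB⟩ := hbdd
          refine ⟨-(|B| + 1) - c, fun a ha => ?_⟩
          have hS : ¬ ∀ᶠ r in l, v r ≤ -(|B| + 1) := fun h => by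
            have := hB h
            linarith [neg_abs_le B]
          obtain ⟨r, hr, h1, h2⟩ := ((not_eventually.1 hS).and_eventually
            ((show ∀ᶠ r in l, u r ≤ a from ha).and (hL (|B| + 1)))).exists
          rw [not_le] at hr
          have h3 := h2 hr.le
          have h4 : -(|B| + 1) ≤ min (v r) (|B| + 1) :=
            le_min hr.le (by linarith [abs_nonneg B])
          linarith
        refine le_of_forall_pos_le_add fun ε hε => ?_
        refine csInf_le hubdd ?_
        set S := sInf {a | ∀ᶠ r in l, v r ≤ a}
        obtain ⟨a, ha, haS⟩ := exists_lt_of_csInf_lt ⟨b, hb⟩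
          (show S < S + ε / 2 by linarith)
        have ha : ∀ᶠ r in l, v r ≤ a := ha
        filter_upwards [ha, hU |a| (ε / 2) (half_pos hε)] with r h1 h2
        have h3 := h2 (h1.trans (le_abs_self a))
        have h4 : max (v r) (-|a|) ≤ a := max_le h1 (neg_abs_le a)
        linarith
      · rw [Real.sInf_of_not_bddBelow hbdd, Real.sInf_of_not_bddBelow]
        intro ⟨B, hB⟩
        refine hbdd ⟨min 0 (B - 1), fun a ha => ?_⟩
        by_contra! hlt
        obtain ⟨h0, h1⟩ := lt_min_iff.1 hlt
        have : a + 1 ∈ {a | ∀ᶠ r in l, u r ≤ a} := by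
          filter_upwards [hU (-a) 1 one_pos, show ∀ᶠ r in l, v r ≤ a from ha] with r h2 h3
          have := h2 (by linarith)
          rwa [neg_neg, max_eq_right h3] at this
        have := hB this
        linarith
    · rw [Set.not_nonempty_iff_eq_empty.1 hne]
      rw [Set.eq_empty_of_forall_notMem (s := {a | ∀ᶠ r in l, u r ≤ a})]
      intro a ha
      apply hne
      refine ⟨|a| + |c| + 1, ?_⟩
      filter_upwards [hL (|a| + |c| + 1), show ∀ᶠ r in l, u r ≤ a from ha] with r h1 h2
      by_contra! h3
      have h4 := h1 (by linarith [abs_nonneg a, abs_nonneg c])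
      rw [min_eq_right h3.le] at h4
      linarith [le_abs_self a, le_abs_self c]

theorem mul_measure_no_return_le {M : Type*} [MeasurableSpace M] {ν : Measure M}
    [IsProbabilityMeasure ν] {Ψ : ℝ → M → M} (hadd : ∀ s t x, Ψ (s + t) x = Ψ s (Ψ t x))
    (hinv : ∀ t, MeasurePreserving (Ψ t) ν ν) {A : Set M} (hA : MeasurableSet A)
    (σ : ℝ) (n : ℕ) :
    ((n + 1 : ℕ) : ENNReal) * ν {x | x ∈ A ∧ ∀ j : ℕ, 1 ≤ j → j ≤ n → Ψ (j * σ) x ∉ A} ≤ 1 := by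
  set E := {x | x ∈ A ∧ ∀ j : ℕ, 1 ≤ j → j ≤ n → Ψ (j * σ) x ∉ A} with hEdef
  have hE : MeasurableSet E := by
    have : E = A ∩ ⋂ j : ℕ, ⋂ _ : 1 ≤ j, ⋂ _ : j ≤ n, Ψ (j * σ) ⁻¹' Aᶜ := by
      ext x
      simp [hEdef]
    rw [this]
    exact hA.inter (.iInter fun j => .iInter fun _ => .iInter fun _ =>
      (hinv _).measurable hA.compl)
  have hlt : ∀ i i' : ℕ, i < i' → i' < n + 1 →
      Disjoint (Ψ (i * σ) ⁻¹' E) (Ψ (i' * σ) ⁻¹' E) := by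
    intro i i' hii hi'
    rw [Set.disjoint_left]
    intro y hy hy'
    apply hy.2 (i' - i) (by omega) (by omega)
    rw [← hadd, Nat.cast_sub hii.le, ← add_mul, sub_add_cancel]
    exact hy'.1
  have hdisj : Set.PairwiseDisjoint (Finset.range (n + 1) : Set ℕ)
      (fun i : ℕ => Ψ (i * σ) ⁻¹' E) := by
    intro i hi i' hi' hne
    simp only [Finset.coe_range, Set.mem_Iio] at hi hi'
    rcases lt_or_gt_of_ne hne with h | h
    · exact hlt i i' h hi'
    · exact (hlt i' i h hi).symm
  calc ((n + 1 : ℕ) : ENNReal) * ν E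
      = ∑ i ∈ Finset.range (n + 1), ν (Ψ (i * σ) ⁻¹' E) := by
        simp [(hinv _).measure_preimage hE.nullMeasurableSet]
    _ = ν (⋃ i ∈ Finset.range (n + 1), Ψ (i * σ) ⁻¹' E) :=
        (measure_biUnion_finset hdisj fun i _ => (hinv _).measurable hE).symm
    _ ≤ 1 := prob_le_one

theorem ae_exists_return_mem {M : Type*} [MeasurableSpace M] {ν : Measure M}
    [IsProbabilityMeasure ν] {Ψ : ℝ → M → M} (hadd : ∀ s t x, Ψ (s + t) x = Ψ s (Ψ t x))
    (hinv : ∀ t, MeasurePreserving (Ψ t) ν ν) {A : Set M} (hA : MeasurableSet A)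
    {S : Set ℝ} (hS : ∀ n : ℕ, ∃ σ : ℝ, ∀ j : ℕ, 1 ≤ j → j ≤ n → j * σ ∈ S) :
    ∀ᵐ x ∂ν, x ∈ A → ∃ t ∈ S, Ψ t x ∈ A := by
  rw [ae_iff]
  refine le_antisymm (ENNReal.le_of_forall_pos_le_add fun ε hε _ => ?_) zero_le
  obtain ⟨n, hn⟩ := ENNReal.exists_inv_nat_lt (a := (ε : ENNReal)) (by simpa using hε.ne')
  obtain ⟨σ, hσ⟩ := hS n
  have h := mul_measure_no_return_le hadd hinv hA σ n
  rw [mul_comm, ← ENNReal.le_div_iff_mul_le (by simp) (by simp), one_div] at h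
  rw [zero_add]
  refine (measure_mono ?_).trans (h.trans ((ENNReal.inv_le_inv.2 ?_).trans hn.le))
  · intro x hx
    simp only [Set.mem_ofPred_eq, Classical.not_imp, not_exists, not_and] at hx
    exact ⟨hx.1, fun j h1 h2 => hx.2 _ (hσ j h1 h2)⟩
  · exact_mod_cast n.le_succ

theorem measure_no_return_to_fiber_le {M ι : Type*} [MeasurableSpace M] {ν : Measure M}
    [IsProbabilityMeasure ν] {Ψ : ℝ → M → M} (hadd : ∀ s t x, Ψ (s + t) x = Ψ s (Ψ t x))
    (hinv : ∀ t, MeasurePreserving (Ψ t) ν ν) [Countable ι] [MeasurableSpace ι]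
    [MeasurableSingletonClass ι] {X : M → ι} (hX : Measurable X) {w : ι → ENNReal}
    (hw : ∀ a, ν (X ⁻¹' {a}) ≤ w a) (hwtop : ∀ a, w a ≠ ⊤) {c : ℝ} (hc : 0 < c) (σ : ℝ) :
    ν {x | ∀ j : ℕ, 1 ≤ j → (j : ℝ) ≤ c / (w (X x)).toReal → X (Ψ (j * σ) x) ≠ X x}
      ≤ (∑' a, w a) / ENNReal.ofReal c := by
  calc ν {x | ∀ j : ℕ, 1 ≤ j → (j : ℝ) ≤ c / (w (X x)).toReal → X (Ψ (j * σ) x) ≠ X x}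
      ≤ ν (⋃ a, {x | x ∈ X ⁻¹' {a} ∧ ∀ j : ℕ, 1 ≤ j → j ≤ ⌊c / (w a).toReal⌋₊ →
          Ψ (j * σ) x ∉ X ⁻¹' {a}}) := by
        refine measure_mono fun x hx => Set.mem_iUnion.2 ⟨X x, rfl, fun j h1 h2 => ?_⟩
        exact hx j h1 ((Nat.le_floor_iff (by positivity)).1 h2)
    _ ≤ ∑' a, ν {x | x ∈ X ⁻¹' {a} ∧ ∀ j : ℕ, 1 ≤ j → j ≤ ⌊c / (w a).toReal⌋₊ →
          Ψ (j * σ) x ∉ X ⁻¹' {a}} := measure_iUnion_le _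
    _ ≤ ∑' a, w a / ENNReal.ofReal c := by
        refine ENNReal.tsum_le_tsum fun a => ?_
        rcases eq_or_ne (w a) 0 with h0 | h0
        · refine (measure_mono fun x hx => hx.1).trans ((hw a).trans ?_)
          simp [h0]
        · have h := mul_measure_no_return_le hadd hinv (hX (measurableSet_singleton a)) σ
            ⌊c / (w a).toReal⌋₊
          rw [mul_comm, ← ENNReal.le_div_iff_mul_le (by simp) (by simp), one_div] at h
          refine h.trans ?_
          have hpos : 0 < (w a).toReal := ENNReal.toReal_pos h0 (hwtop a)
          rw [← ENNReal.inv_div (by simp) (by simp [hc]), ENNReal.inv_le_inv,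
            ← ENNReal.ofReal_toReal (hwtop a), ← ENNReal.ofReal_div_of_pos hpos,
            ← ENNReal.ofReal_natCast]
          apply ENNReal.ofReal_le_ofReal
          rw [ENNReal.toReal_ofReal hpos.le]
          exact_mod_cast (Nat.lt_floor_add_one _).le
    _ = (∑' a, w a) / ENNReal.ofReal c := by
        simp_rw [div_eq_mul_inv]
        exact ENNReal.tsum_mul_right

/-- The index of the cell of the grid of mesh `δ` that contains `z`. -/
noncomputable def gridIndex {N : ℕ} (δ : ℝ) (z : EuclideanSpace ℝ (Fin N)) : Fin N → ℤ :=
  fun i => ⌊z i / δ⌋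

theorem measurable_gridIndex {N : ℕ} (δ : ℝ) : Measurable (gridIndex (N := N) δ) := by
  refine measurable_pi_iff.2 fun i => Measurable.floor ?_
  exact Measurable.div_const (by fun_prop) _

theorem dist_lt_of_gridIndex_eq {N : ℕ} {r : ℝ} (hr : 0 < r) {z w : EuclideanSpace ℝ (Fin N)}
    (h : gridIndex (r / (N + 1)) z = gridIndex (r / (N + 1)) w) : dist z w < r := by
  set δ := r / ((N : ℝ) + 1) with hδ
  have hδ0 : 0 < δ := by positivity
  have hcoord : ∀ i, dist (z i) (w i) ^ 2 ≤ δ ^ 2 := by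
    intro i
    have h1 := Int.abs_sub_lt_one_of_floor_eq_floor (congrFun h i)
    rw [← sub_div, abs_div, abs_of_pos hδ0, div_lt_one hδ0] at h1
    rw [Real.dist_eq]
    gcongr
  rw [EuclideanSpace.dist_eq, Real.sqrt_lt' hr]
  calc ∑ i, dist (z i) (w i) ^ 2 ≤ ∑ _i : Fin N, δ ^ 2 := Finset.sum_le_sum fun i _ => hcoord i
    _ = N * δ ^ 2 := by simp
    _ < ((N + 1) * δ) ^ 2 := by
      have hN : (0 : ℝ) ≤ N := N.cast_nonneg
      nlinarith [pow_pos hδ0 2, mul_nonneg hN (pow_pos hδ0 2).le,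
        mul_nonneg (mul_nonneg hN hN) (pow_pos hδ0 2).le]
    _ = r ^ 2 := by rw [hδ]; field_simp

/-- The displacements between a cell of mesh `r / (N + 1)` and the cells within distance
`2 * r` of it. -/
noncomputable def gridNeighbors (N : ℕ) : Finset (Fin N → ℤ) :=
  Fintype.piFinset fun _ => Finset.Icc (-(2 * (N + 1) + 1) : ℤ) (2 * (N + 1) + 1)

theorem gridIndex_sub_mem_gridNeighbors {N : ℕ} {r : ℝ} (hr : 0 < r)
    {z w : EuclideanSpace ℝ (Fin N)} (h : w ∈ ball z (2 * r)) :
    gridIndex (r / (N + 1)) w - gridIndex (r / (N + 1)) z ∈ gridNeighbors N := by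
  rw [gridNeighbors, Fintype.mem_piFinset]
  intro i
  have h1 : |w i - z i| < 2 * r := by
    have := PiLp.norm_apply_le (w - z) i
    rw [mem_ball, dist_eq_norm] at h
    exact this.trans_lt h
  have hN : (0 : ℝ) < (N : ℝ) + 1 := by positivity
  have hδ : 0 < r / ((N : ℝ) + 1) := by positivity
  have h2 : |w i / (r / (N + 1)) - z i / (r / (N + 1))| < 2 * (N + 1) := by
    rw [← sub_div, abs_div, abs_of_pos hδ, div_lt_iff₀ hδ]
    calc _ < 2 * r := h1
      _ = _ := by field_simp
  obtain ⟨h3, h4⟩ := abs_lt.1 h2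
  simp only [Pi.sub_apply, gridIndex, Finset.mem_Icc]
  have a1 := Int.floor_le (w i / (r / (N + 1)))
  have a2 := Int.lt_floor_add_one (w i / (r / (N + 1)))
  have b1 := Int.floor_le (z i / (r / (N + 1)))
  have b2 := Int.lt_floor_add_one (z i / (r / (N + 1)))
  constructor
  · rw [← Int.cast_le (R := ℝ)]
    push_cast
    linarith
  · rw [← Int.cast_le (R := ℝ)]
    push_cast
    linarith

theorem tsum_measure_gridNeighbors {N : ℕ} (m : Measure (EuclideanSpace ℝ (Fin N)))
    [IsProbabilityMeasure m] (δ : ℝ) :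
    ∑' a, ∑ d ∈ gridNeighbors N, m (gridIndex δ ⁻¹' {a + d}) = ((gridNeighbors N).card : ENNReal) := by
  have h1 : ∑' a, m (gridIndex (N := N) δ ⁻¹' {a}) = 1 := by
    rw [← tsum_univ, tsum_measure_preimage_singleton Set.countable_univ fun a _ =>
      measurable_gridIndex δ (measurableSet_singleton a)]
    simp
  rw [Summable.tsum_finsetSum fun _ _ => ENNReal.summable]
  have h2 : ∀ d, ∑' a, m (gridIndex (N := N) δ ⁻¹' {a + d}) = 1 := fun d => by
    rw [← h1]
    exact (Equiv.addRight d).tsum_eq fun a => m (gridIndex (N := N) δ ⁻¹' {a})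
  simp [h2]

theorem measure_no_return_to_ball_le {M : Type*} [MeasurableSpace M] {ν : Measure M}
    [IsProbabilityMeasure ν] {Ψ : ℝ → M → M} (hadd : ∀ s t x, Ψ (s + t) x = Ψ s (Ψ t x))
    (hinv : ∀ t, MeasurePreserving (Ψ t) ν ν) {N : ℕ} {f : M → EuclideanSpace ℝ (Fin N)}
    (hf : Measurable f) {r c : ℝ} (hr : 0 < r) (hc : 0 < c) (σ : ℝ) :
    ν {x | 0 < (ν.map f).real (ball (f x) (2 * r)) ∧
        ∀ j : ℕ, 1 ≤ j → (j : ℝ) ≤ c / (ν.map f).real (ball (f x) (2 * r)) →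
          f (Ψ (j * σ) x) ∉ ball (f x) r}
      ≤ ((gridNeighbors N).card : ENNReal) / ENNReal.ofReal c := by
  have : IsProbabilityMeasure (ν.map f) := Measure.isProbabilityMeasure_map hf.aemeasurable
  set δ := r / ((N : ℝ) + 1) with hδ
  set w : (Fin N → ℤ) → ENNReal := fun a =>
    ∑ d ∈ gridNeighbors N, (ν.map f) (gridIndex δ ⁻¹' {a + d}) with hw
  have hwtop : ∀ a, w a ≠ ⊤ := fun a => ENNReal.sum_ne_top.2 fun d _ => measure_ne_top _ _
  have h0 : (0 : Fin N → ℤ) ∈ gridNeighbors N := by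
    rw [gridNeighbors, Fintype.mem_piFinset]
    intro i
    simp only [Pi.zero_apply, Finset.mem_Icc]
    omega
  have hfib : ∀ a, ν ((gridIndex δ ∘ f) ⁻¹' {a}) ≤ w a := by
    intro a
    rw [Set.preimage_comp, ← Measure.map_apply hf
      (measurable_gridIndex δ (measurableSet_singleton a))]
    have := Finset.single_le_sum
      (f := fun d => (ν.map f) (gridIndex δ ⁻¹' {a + d})) (fun _ _ => zero_le) h0
    simpa using this
  have hball : ∀ z, (ν.map f) (ball z (2 * r)) ≤ w (gridIndex δ z) := by
    intro z
    refine (measure_mono ?_).trans (measure_biUnion_finset_le (gridNeighbors N)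
      fun d => gridIndex δ ⁻¹' {gridIndex δ z + d})
    intro y hy
    refine Set.mem_biUnion (gridIndex_sub_mem_gridNeighbors hr hy) ?_
    simp [hδ]
  refine (measure_mono ?_).trans ((measure_no_return_to_fiber_le hadd hinv
    ((measurable_gridIndex δ).comp hf) hfib hwtop hc σ).trans_eq ?_)
  · rintro x ⟨hx0, hx⟩ j hj hjc heq
    refine hx j hj (hjc.trans ?_) (dist_lt_of_gridIndex_eq hr heq)
    exact div_le_div_of_nonneg_left hc.le hx0
      (ENNReal.toReal_mono (hwtop _) (hball (f x)))
  · rw [hw, tsum_measure_gridNeighbors]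

theorem ae_eventually_return_to_ball {M : Type*} [MeasurableSpace M] {ν : Measure M}
    [IsProbabilityMeasure ν] {Ψ : ℝ → M → M} (hadd : ∀ s t x, Ψ (s + t) x = Ψ s (Ψ t x))
    (hinv : ∀ t, MeasurePreserving (Ψ t) ν ν) {N : ℕ} {f : M → EuclideanSpace ℝ (Fin N)}
    (hf : Measurable f) :
    ∀ᵐ x ∂ν, ∀ᶠ k : ℕ in atTop, ∀ i : ℤ, |i| ≤ (k : ℤ) ^ 2 → ∀ σ : ℝ, |σ| = 2 ^ i →
      0 < (ν.map f).real (ball (f x) (2 * (1 / 2) ^ k)) →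
        ∃ j : ℕ, 1 ≤ j ∧
          (j : ℝ) ≤ ((k : ℝ) + 1) ^ 4 / (ν.map f).real (ball (f x) (2 * (1 / 2) ^ k)) ∧
          f (Ψ (j * σ) x) ∈ ball (f x) ((1 / 2) ^ k) := by
  let bad : ℕ → ℝ → Set M := fun k σ =>
    {x | 0 < (ν.map f).real (ball (f x) (2 * (1 / 2) ^ k)) ∧
        ∀ j : ℕ, 1 ≤ j →
          (j : ℝ) ≤ ((k : ℝ) + 1) ^ 4 / (ν.map f).real (ball (f x) (2 * (1 / 2) ^ k)) →
          f (Ψ (j * σ) x) ∉ ball (f x) ((1 / 2) ^ k)}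
  obtain ⟨K, hK⟩ : ∃ K : ℝ, K = ((gridNeighbors N).card : ℝ) := ⟨_, rfl⟩
  have hKn : 0 ≤ K := hK ▸ Nat.cast_nonneg _
  have hmeas : ∀ k σ, ν (bad k σ) ≤ ENNReal.ofReal (K / ((k : ℝ) + 1) ^ 4) := by
    intro k σ
    have hk : (0 : ℝ) < ((k : ℝ) + 1) ^ 4 := by positivity
    rw [ENNReal.ofReal_div_of_pos hk, hK, ENNReal.ofReal_natCast]
    exact measure_no_return_to_ball_le hadd hinv hf (by positivity) hk σ
  have hsum : ∑' k : ℕ, ν (⋃ i ∈ Finset.Icc (-(k : ℤ) ^ 2) ((k : ℤ) ^ 2),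
      (bad k (2 ^ i) ∪ bad k (-2 ^ i))) ≠ ⊤ := by
    have hS : Summable fun k : ℕ => 4 * K * (1 / ((k + 1 : ℕ) : ℝ) ^ 2) :=
      ((summable_nat_add_iff 1).2 (Real.summable_one_div_nat_pow.2 one_lt_two)).mul_left _
    refine ne_top_of_le_ne_top hS.tsum_ofReal_ne_top (ENNReal.tsum_le_tsum fun k => ?_)
    calc _ ≤ ∑ i ∈ Finset.Icc (-(k : ℤ) ^ 2) ((k : ℤ) ^ 2),
          ν (bad k (2 ^ i) ∪ bad k (-2 ^ i)) := measure_biUnion_finset_le _ _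
      _ ≤ ∑ i ∈ Finset.Icc (-(k : ℤ) ^ 2) ((k : ℤ) ^ 2),
          ENNReal.ofReal (2 * (K / ((k : ℝ) + 1) ^ 4)) := by
        refine Finset.sum_le_sum fun i _ => (measure_union_le _ _).trans ?_
        rw [two_mul, ENNReal.ofReal_add (by positivity) (by positivity)]
        exact add_le_add (hmeas _ _) (hmeas _ _)
      _ = ENNReal.ofReal ((2 * (k : ℝ) ^ 2 + 1) * (2 * (K / ((k : ℝ) + 1) ^ 4))) := by
        have hcard : ((Finset.Icc (-(k : ℤ) ^ 2) ((k : ℤ) ^ 2)).card) = 2 * k ^ 2 + 1 := by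
          rw [Int.card_Icc]
          zify
          rw [Int.toNat_of_nonneg (by linarith [sq_nonneg (k : ℤ)])]
          ring
        rw [Finset.sum_const, hcard, nsmul_eq_mul,
          ENNReal.ofReal_mul (p := 2 * (k : ℝ) ^ 2 + 1) (by positivity),
          ← ENNReal.ofReal_natCast]
        push_cast
        rfl
      _ ≤ _ := by
        apply ENNReal.ofReal_le_ofReal
        push_cast
        have hk : (0 : ℝ) ≤ k := k.cast_nonneg
        rw [← mul_div_assoc, ← mul_div_assoc, mul_one_div, div_le_div_iff₀ (by positivity)
          (by positivity)]
        have : 2 * (k : ℝ) ^ 2 + 1 ≤ 2 * (k + 1) ^ 2 := by nlinarith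
        calc (2 * (k : ℝ) ^ 2 + 1) * (2 * K) * (k + 1) ^ 2
            ≤ (2 * (k + 1) ^ 2) * (2 * K) * (k + 1) ^ 2 := by gcongr
          _ = 4 * K * (k + 1) ^ 4 := by ring
  filter_upwards [ae_eventually_notMem hsum] with x hx
  filter_upwards [hx] with k hk i hi σ hσ hpos
  by_contra! hno
  refine hk (Set.mem_iUnion₂.2 ⟨i, Finset.mem_Icc.2 (abs_le.1 hi), ?_⟩)
  rcases eq_or_eq_neg_of_abs_eq hσ with h | h
  · left; rw [← h]; exact ⟨hpos, hno⟩
  · right; rw [← h]; exact ⟨hpos, hno⟩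

theorem ae_eventually_pow_le_measure_ball {N : ℕ} (m : Measure (EuclideanSpace ℝ (Fin N)))
    [IsProbabilityMeasure m] :
    ∀ᵐ z ∂m, ∀ᶠ r : ℝ in 𝓝[>] 0, r ^ (N + 1) ≤ m.real (ball z r) := by
  filter_upwards [Besicovitch.ae_tendsto_rnDeriv volume m, Measure.rnDeriv_lt_top volume m]
    with z hz hfin
  obtain ⟨c, hc1, hc2⟩ := exists_between hfin
  have hc0 : 0 < c.toReal := ENNReal.toReal_pos (pos_of_gt hc1).ne' hc2.ne
  set V := (volume (ball (0 : EuclideanSpace ℝ (Fin N)) 1)).toReal with hV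
  have hV0 : 0 < V := ENNReal.toReal_pos (measure_ball_pos _ _ one_pos).ne' measure_ball_lt_top.ne
  have hhalf : Tendsto (fun r : ℝ => r / 2) (𝓝[>] 0) (𝓝[>] 0) := by
    refine tendsto_nhdsWithin_iff.2 ⟨?_, ?_⟩
    · have : Tendsto (fun r : ℝ => r / 2) (𝓝 0) (𝓝 (0 / 2)) := tendsto_id.div_const 2
      rw [zero_div] at this
      exact this.mono_left nhdsWithin_le_nhds
    · filter_upwards [self_mem_nhdsWithin] with r hr
      exact half_pos (show (0 : ℝ) < r from hr)
  have hsmall : ∀ᶠ r : ℝ in 𝓝[>] 0, r < V / 2 ^ N / c.toReal :=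
    nhdsWithin_le_nhds (Iio_mem_nhds (by positivity))
  filter_upwards [hhalf.eventually (hz.eventually_lt_const hc1), hsmall, self_mem_nhdsWithin]
    with r h1 h2 hr
  have hr : 0 < r := hr
  have h3 := (ENNReal.div_le_iff_le_mul (Or.inr hc2.ne) (Or.inl (measure_ne_top _ _))).1 h1.le
  rw [Measure.addHaar_closedBall _ _ (half_pos hr).le, finrank_euclideanSpace,
    Fintype.card_fin] at h3
  have h4 := ENNReal.toReal_mono (ENNReal.mul_ne_top hc2.ne (measure_ne_top _ _)) h3
  rw [ENNReal.toReal_mul, ENNReal.toReal_mul, ENNReal.toReal_ofReal (by positivity), ← hV,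
    div_pow] at h4
  have h5 : (m (closedBall z (r / 2))).toReal ≤ m.real (ball z r) :=
    measureReal_mono (closedBall_subset_ball (half_lt_self hr))
  rw [lt_div_iff₀ hc0] at h2
  refine le_of_mul_le_mul_left ?_ hc0
  calc c.toReal * r ^ (N + 1) = r ^ N * (r * c.toReal) := by ring
    _ ≤ r ^ N * (V / 2 ^ N) := by gcongr
    _ = r ^ N / 2 ^ N * V := by ring
    _ ≤ c.toReal * (m (closedBall z (r / 2))).toReal := h4
    _ ≤ c.toReal * m.real (ball z r) := by gcongr

theorem abs_le_sq_of_abs_mul_log_two_le {i : ℤ} {k : ℕ} {B L : ℝ} (hL : 1 ≤ L)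
    (hB : 2 * B + 2 ≤ L)
    (hk : L ≤ k) (h : |i * Real.log 2| ≤ B * L + 1) : |i| ≤ (k : ℤ) ^ 2 := by
  have h2 := Real.log_two_gt_d9
  rw [abs_mul, abs_of_pos (by linarith : 0 < Real.log 2)] at h
  have h3 : |(i : ℝ)| ≤ (k : ℝ) ^ 2 := by nlinarith [abs_nonneg (i : ℝ), hL]
  exact_mod_cast h3

theorem exists_half_pow_lt_le {r : ℝ} (hr : 0 < r) (hr1 : r < 1) :
    ∃ k : ℕ, (1 / 2 : ℝ) ^ k < r ∧ r ≤ 2 * (1 / 2) ^ k ∧ -Real.log r ≤ k ∧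
      (k : ℝ) + 1 ≤ 2 * (-Real.log r) + 2 := by
  obtain ⟨k, hk1, hk2⟩ := exists_nat_pow_near_of_lt_one (y := (1 / 2 : ℝ)) hr hr1.le
    (by norm_num) (by norm_num)
  have hl2 := Real.log_two_gt_d9
  have hl2' := Real.log_two_lt_d9
  have hlog : ∀ k : ℕ, Real.log ((1 / 2 : ℝ) ^ k) = -(k * Real.log 2) := fun k => by
    rw [Real.log_pow, one_div, Real.log_inv]; ring
  have h1 := Real.log_lt_log (by positivity) hk1
  have h2 := Real.log_le_log hr hk2
  rw [hlog] at h1 h2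
  push_cast at h1
  have hk0 : (0 : ℝ) ≤ k := k.cast_nonneg
  have h3 : ((k : ℝ) + 1) * Real.log 2 ≤ ((k : ℝ) + 1) * 1 := by gcongr; linarith
  have h4 : (k : ℝ) * (1 / 2) ≤ k * Real.log 2 := by gcongr; linarith
  refine ⟨k + 1, hk1, ?_, ?_, ?_⟩
  · rw [pow_succ]; linarith
  · push_cast; linarith
  · push_cast; linarith

theorem eventually_exists_mem_windows {β : ℝ → ℝ} {V : ℝ → Set ℝ} (hβ : Monotone β)
    (hV : Monotone V) (hβ1 : ∀ r, β r ≤ 1) {n : ℕ} (hlow : ∀ᶠ r : ℝ in 𝓝[>] 0, r ^ n ≤ β r)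
    (hret : ∀ᶠ k : ℕ in atTop, ∀ i : ℤ, |i| ≤ (k : ℤ) ^ 2 → ∀ σ : ℝ, |σ| = 2 ^ i →
      0 < β (2 * (1 / 2) ^ k) → ∃ j : ℕ, 1 ≤ j ∧
        (j : ℝ) ≤ ((k : ℝ) + 1) ^ 4 / β (2 * (1 / 2) ^ k) ∧ j * σ ∈ V ((1 / 2) ^ k))
    {C : ℝ} (hC : 0 ≤ C) {ε : ℝ} (hε : 0 < ε) :
    ∀ᶠ r : ℝ in 𝓝[>] 0, ∀ s : ℝ, 0 < s → |Real.log s| ≤ C * (-Real.log r) →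
      (∃ t ∈ V r, s < t ∧
        Real.log t ≤ Real.log s - Real.log (β r) + ε * (-Real.log r)) ∧
      (∃ t ∈ V r, -s < t ∧ t < 0 ∧
        Real.log s + Real.log (β r) - ε * (-Real.log r) ≤ Real.log (-t)) := by
  have hLtop : Tendsto (fun r : ℝ => -Real.log r) (𝓝[>] 0) atTop :=
    tendsto_neg_atBot_atTop.comp Real.tendsto_log_nhdsGT_zero
  obtain ⟨k₀, hk₀⟩ := eventually_atTop.1 hret
  have hlog : ∀ᶠ L : ℝ in atTop, Real.log 2 + 4 * Real.log (2 * L + 2) ≤ ε * L := by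
    have h1 : Tendsto (fun L : ℝ => 2 * L + 2) atTop atTop :=
      tendsto_atTop_add_const_right _ _ (tendsto_id.const_mul_atTop two_pos)
    have h2 := h1.eventually (Real.isLittleO_log_id_atTop.bound (by positivity : 0 < ε / 16))
    filter_upwards [h2, eventually_ge_atTop (2 / ε + 1)] with L h3 h4
    have h5 : 1 ≤ ε * (L - 1) / 2 := by
      have : 2 / ε ≤ L - 1 := by linarith
      rw [div_le_iff₀ hε] at this
      linarith
    have hL : 0 < 2 * L + 2 := by
      have : 0 < 2 / ε := by positivity
      linarith
    rw [Real.norm_eq_abs, Real.norm_eq_abs, id, abs_of_pos hL] at h3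
    have h6 := (le_abs_self _).trans h3
    linarith [Real.log_two_lt_d9]
  filter_upwards [hlow, self_mem_nhdsWithin, hLtop.eventually hlog,
    hLtop.eventually (eventually_ge_atTop (k₀ : ℝ)), hLtop.eventually (eventually_ge_atTop 1),
    hLtop.eventually (eventually_ge_atTop (2 * (C + n + ε) + 2))] with r hbr hr hlogr hrk hL1 hLB
  have hr : 0 < r := hr
  intro s hs hsC
  set L := -Real.log r with hLdef
  have hr1 : r < 1 := by
    by_contra! h
    linarith [Real.log_nonneg h]
  obtain ⟨k, hk1, hk3, hLk', hkL'⟩ := exists_half_pow_lt_le hr hr1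
  rw [← hLdef] at hLk' hkL'
  have hl2 := Real.log_two_gt_d9
  have hl2' := Real.log_two_lt_d9
  have hlogk : Real.log 2 + 4 * Real.log (k + 1) ≤ ε * L := by
    have := Real.log_le_log (by positivity) hkL'
    linarith
  have hlogk0 : 0 ≤ Real.log ((k : ℝ) + 1) :=
    Real.log_nonneg (by linarith [(k.cast_nonneg : (0 : ℝ) ≤ k)])
  have hb0 : 0 < β r := (pow_pos hr n).trans_le hbr
  have hb' : β r ≤ β (2 * (1 / 2) ^ k) := hβ hk3
  have hb'0 : 0 < β (2 * (1 / 2) ^ k) := hb0.trans_le hb'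
  have hlogb : Real.log (β r) ≤ Real.log (β (2 * (1 / 2) ^ k)) := Real.log_le_log hb0 hb'
  have hlogb0 : Real.log (β (2 * (1 / 2) ^ k)) ≤ 0 := Real.log_nonpos hb'0.le (hβ1 _)
  have hlogbn : -(n * L) ≤ Real.log (β r) := by
    have := Real.log_le_log (by positivity) hbr
    rw [Real.log_pow] at this
    linarith
  set W : ℝ := ((k : ℝ) + 1) ^ 4 / β (2 * (1 / 2) ^ k) with hW
  have hW0 : 0 < W := by positivity
  have hlogW : Real.log W = 4 * Real.log (k + 1) - Real.log (β (2 * (1 / 2) ^ k)) := by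
    rw [hW, Real.log_div (by positivity) hb'0.ne', Real.log_pow]
    norm_num
  have hk₀k : k₀ ≤ k := by
    have : (k₀ : ℝ) ≤ k := hrk.trans hLk'
    exact_mod_cast this
  have hVr : V ((1 / 2) ^ k) ⊆ V r := hV hk1.le
  obtain ⟨hs1, hs2⟩ := abs_le.1 hsC
  clear_value W L
  have hnL : 0 ≤ n * L := by positivity
  have hεL : 0 ≤ ε * L := by positivity
  constructor
  · obtain ⟨i, hi1, hi2⟩ := exists_mem_Ico_zpow hs one_lt_two
    have hi1' := Real.log_le_log (by positivity) hi1
    have hi2' := Real.log_lt_log hs hi2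
    rw [Real.log_zpow] at hi1' hi2'
    push_cast at hi2'
    have hi : |i + 1| ≤ (k : ℤ) ^ 2 := by
      refine abs_le_sq_of_abs_mul_log_two_le hL1 hLB hLk' (abs_le.2 ⟨?_, ?_⟩) <;>
        push_cast <;> linarith
    obtain ⟨j, hj1, hjW, hjV⟩ := hk₀ k hk₀k (i + 1) hi (2 ^ (i + 1))
      (abs_of_pos (by positivity)) hb'0
    rw [← hW] at hjW
    have hj1' : (1 : ℝ) ≤ j := by exact_mod_cast hj1
    have hp : (0 : ℝ) < 2 ^ (i + 1) := by positivity
    refine ⟨_, hVr hjV, hi2.trans_le (le_mul_of_one_le_left hp.le hj1'), ?_⟩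
    have := Real.log_le_log (by linarith) hjW
    rw [Real.log_mul (by linarith) hp.ne', Real.log_zpow]
    push_cast
    linarith
  · obtain ⟨i, hi1, hi2⟩ := exists_mem_Ioc_zpow (div_pos hs hW0) one_lt_two
    have hi1' := Real.log_lt_log (by positivity) hi1
    have hi2' := Real.log_le_log (div_pos hs hW0) hi2
    rw [Real.log_zpow, Real.log_div hs.ne' hW0.ne'] at hi1' hi2'
    push_cast at hi2'
    have hi : |i| ≤ (k : ℤ) ^ 2 := by
      refine abs_le_sq_of_abs_mul_log_two_le hL1 hLB hLk' (abs_le.2 ⟨?_, ?_⟩) <;> linarith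
    have hp : (0 : ℝ) < 2 ^ i := by positivity
    obtain ⟨j, hj1, hjW, hjV⟩ := hk₀ k hk₀k i hi (-2 ^ i)
      (by rw [abs_neg, abs_of_pos hp]) hb'0
    rw [← hW] at hjW
    have hj1' : (1 : ℝ) ≤ j := by exact_mod_cast hj1
    rw [lt_div_iff₀ hW0] at hi1
    refine ⟨_, hVr hjV, ?_, ?_, ?_⟩
    · rw [mul_neg, neg_lt_neg_iff]
      exact (mul_le_mul_of_nonneg_right hjW hp.le).trans_lt (by rwa [mul_comm])
    · rw [mul_neg, neg_lt_zero]
      exact mul_pos (by linarith) hp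
    · rw [mul_neg, neg_neg]
      have h7 := Real.log_le_log hp (le_mul_of_one_le_left hp.le hj1')
      rw [Real.log_zpow] at h7
      linarith

theorem sInf_lt_and_mem_bounds {V : Set ℝ} {ρ : ℝ} (htop : ∀ s, ∃ t ∈ V, s < t)
    (hpos : ∀ δ > (0 : ℝ), ∃ t ∈ V, 0 < t ∧ t < δ)
    (hneg : ∀ δ > (0 : ℝ), ∃ t ∈ V, -δ < t ∧ t < 0) :
    ρ ≤ sInf {t | ρ < t ∧ t ∈ V} ∧ (ρ = 0 → sInf {t | ρ < t ∧ t ∈ V} = 0) ∧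
      (ρ < 0 → sInf {t | ρ < t ∧ t ∈ V} < 0) := by
  have hbdd : BddBelow {t | ρ < t ∧ t ∈ V} := ⟨ρ, fun t ht => ht.1.le⟩
  obtain ⟨t₀, ht₀, ht₀ρ⟩ := htop ρ
  have hle : ρ ≤ sInf {t | ρ < t ∧ t ∈ V} := le_csInf ⟨t₀, ht₀ρ, ht₀⟩ fun t ht => ht.1.le
  refine ⟨hle, fun h0 => le_antisymm (le_of_forall_pos_le_add fun δ hδ => ?_) (h0 ▸ hle),
    fun h0 => ?_⟩
  · obtain ⟨t, ht, ht0, htδ⟩ := hpos δ hδ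
    rw [zero_add]
    exact (csInf_le hbdd ⟨h0 ▸ ht0, ht⟩).trans htδ.le
  · obtain ⟨t, ht, ht1, ht2⟩ := hneg (-ρ) (neg_pos.2 h0)
    rw [neg_neg] at ht1
    exact (csInf_le hbdd ⟨ht1, ht⟩).trans_lt ht2

theorem liminf_limsup_log_sInf_le {β ρ : ℝ → ℝ} {V : ℝ → Set ℝ} {n : ℕ} (hβ1 : ∀ r, β r ≤ 1)
    (hlow : ∀ᶠ r : ℝ in 𝓝[>] 0, r ^ n ≤ β r)
    (htop : ∀ r > 0, ∀ s, ∃ t ∈ V r, s < t)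
    (hpos : ∀ r > 0, ∀ δ > (0 : ℝ), ∃ t ∈ V r, 0 < t ∧ t < δ)
    (hneg : ∀ r > 0, ∀ δ > (0 : ℝ), ∃ t ∈ V r, -δ < t ∧ t < 0)
    (hwin : ∀ C : ℝ, 0 ≤ C → ∀ ε : ℝ, 0 < ε → ∀ᶠ r : ℝ in 𝓝[>] 0, ∀ s : ℝ, 0 < s →
      |Real.log s| ≤ C * (-Real.log r) →
      (∃ t ∈ V r, s < t ∧
        Real.log t ≤ Real.log s - Real.log (β r) + ε * (-Real.log r)) ∧
      (∃ t ∈ V r, -s < t ∧ t < 0 ∧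
        Real.log s + Real.log (β r) - ε * (-Real.log r) ≤ Real.log (-t))) :
    liminf (fun r => Real.log (sInf {t | ρ r < t ∧ t ∈ V r}) / (-Real.log r)) (𝓝[>] 0)
        ≤ liminf (fun r => Real.log (β r) / Real.log r - Real.log (ρ r) / Real.log r) (𝓝[>] 0) ∧
      limsup (fun r => Real.log (sInf {t | ρ r < t ∧ t ∈ V r}) / (-Real.log r)) (𝓝[>] 0)
        ≤ limsup (fun r => Real.log (β r) / Real.log r - Real.log (ρ r) / Real.log r) (𝓝[>] 0) := by
  have hv : ∀ r, Real.log (β r) / Real.log r - Real.log (ρ r) / Real.log r =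
      (Real.log (ρ r) - Real.log (β r)) / (-Real.log r) := fun r => by
    rw [div_neg, ← sub_div, ← neg_div, neg_sub]
  simp_rw [hv]
  have hLpos : ∀ᶠ r : ℝ in 𝓝[>] 0, 0 < -Real.log r :=
    (tendsto_neg_atBot_atTop.comp Real.tendsto_log_nhdsGT_zero).eventually (eventually_gt_atTop 0)
  have hβlog : ∀ᶠ r : ℝ in 𝓝[>] 0,
      -(n * (-Real.log r)) ≤ Real.log (β r) ∧ Real.log (β r) ≤ 0 := by
    filter_upwards [hlow, self_mem_nhdsWithin] with r h hr
    have hr : 0 < r := hr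
    have h1 := Real.log_le_log (pow_pos hr n) h
    rw [Real.log_pow] at h1
    exact ⟨by linarith, Real.log_nonpos ((pow_pos hr n).trans_le h).le (hβ1 r)⟩
  apply liminf_le_and_limsup_le_of_eventually
  · intro A ε hε
    set C : ℝ := |A| + n with hC
    filter_upwards [hLpos, hβlog, hwin C (by positivity) ε hε, self_mem_nhdsWithin]
      with r hL ⟨hb1, hb2⟩ hw hr hvA
    obtain ⟨hle, hzero, hlt⟩ :=
      sInf_lt_and_mem_bounds (ρ := ρ r) (htop r hr) (hpos r hr) (hneg r hr)
    have hbdd : BddBelow {t | ρ r < t ∧ t ∈ V r} := ⟨ρ r, fun t ht => ht.1.le⟩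
    set L := -Real.log r
    set τ := sInf {t | ρ r < t ∧ t ∈ V r}
    have hAL : |A| * L ≥ A * L := by gcongr; exact le_abs_self A
    have hnL : 0 ≤ n * L := by positivity
    suffices h : Real.log τ ≤ Real.log (ρ r) - Real.log (β r) + ε * L ∨
        Real.log τ ≤ -A * L + ε * L by
      rw [max_add, le_max_iff, div_le_iff₀ hL, div_le_iff₀ hL, add_mul, add_mul,
        div_mul_cancel₀ _ hL.ne']
      exact h
    have hεL : 0 ≤ ε * L := by positivity
    rcases lt_trichotomy (ρ r) 0 with h0 | h0 | h0
    · left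
      have := Real.log_le_log (neg_pos.2 (hlt h0)) (neg_le_neg hle)
      rw [Real.log_neg_eq_log, Real.log_neg_eq_log] at this
      linarith
    · left
      rw [hzero h0, h0, Real.log_zero]
      linarith
    · rw [div_le_iff₀ hL] at hvA
      set s := Real.exp (max (Real.log (ρ r)) (-(C * L))) with hs
      have hCL : C * L = |A| * L + n * L := by rw [hC]; ring
      have hslog : |Real.log s| ≤ C * L := by
        rw [hs, Real.log_exp, abs_le]
        refine ⟨le_max_right _ _, max_le (by linarith) ?_⟩
        have : 0 ≤ C * L := by positivity
        linarith
      obtain ⟨⟨t, htV, hst, ht⟩, -⟩ := hw s (Real.exp_pos _) hslog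
      have hρs : ρ r ≤ s := by
        rw [← Real.log_le_iff_le_exp h0]
        exact le_max_left _ _
      have hτ : Real.log τ ≤ Real.log t :=
        Real.log_le_log (h0.trans_le hle) (csInf_le hbdd ⟨hρs.trans_lt hst, htV⟩)
      rw [hs, Real.log_exp] at ht
      rcases le_total (Real.log (ρ r)) (-(C * L)) with h1 | h1
      · right
        rw [max_eq_right h1] at ht
        linarith
      · left
        rw [max_eq_left h1] at ht
        linarith
  · refine ⟨2 * n + 1, fun C => ?_⟩
    set C' : ℝ := |C| + n with hC'
    filter_upwards [hLpos, hβlog, hwin C' (by positivity) 1 one_pos, self_mem_nhdsWithin]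
      with r hL ⟨hb1, hb2⟩ hw hr hvC
    obtain ⟨hle, hzero, hlt⟩ :=
      sInf_lt_and_mem_bounds (ρ := ρ r) (htop r hr) (hpos r hr) (hneg r hr)
    have hbdd : BddBelow {t | ρ r < t ∧ t ∈ V r} := ⟨ρ r, fun t ht => ht.1.le⟩
    set L := -Real.log r
    set τ := sInf {t | ρ r < t ∧ t ∈ V r}
    have hCL : |C| * L ≥ C * L := by gcongr; exact le_abs_self C
    have hnL : 0 ≤ n * L := by positivity
    rw [le_div_iff₀ hL] at hvC
    suffices h : Real.log (ρ r) - Real.log (β r) - (2 * n + 1) * L ≤ Real.log τ ∨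
        C * L - (2 * n + 1) * L ≤ Real.log τ by
      rw [le_div_iff₀ hL, sub_mul, min_mul_of_nonneg _ _ hL.le, div_mul_cancel₀ _ hL.ne',
        ← min_sub_sub_right, min_le_iff]
      exact h
    rcases lt_trichotomy (ρ r) 0 with h0 | h0 | h0
    · set s := Real.exp (min (Real.log (ρ r)) (C' * L)) with hs
      have hC'L : C' * L = |C| * L + n * L := by rw [hC']; ring
      have hslog : |Real.log s| ≤ C' * L := by
        rw [hs, Real.log_exp, abs_le]
        refine ⟨le_min (by linarith) ?_, min_le_right _ _⟩
        have : 0 ≤ C' * L := by positivity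
        linarith
      obtain ⟨-, t, htV, hst, ht0, ht⟩ := hw s (Real.exp_pos _) hslog
      have hρs : s ≤ -ρ r := by
        rw [← Real.le_log_iff_exp_le (neg_pos.2 h0), Real.log_neg_eq_log]
        exact min_le_left _ _
      have hτ : Real.log (-t) ≤ Real.log τ := by
        rw [← Real.log_neg_eq_log τ]
        exact Real.log_le_log (neg_pos.2 ht0)
          (neg_le_neg (csInf_le hbdd ⟨by linarith, htV⟩))
      rw [hs, Real.log_exp] at ht
      rcases le_total (Real.log (ρ r)) (C' * L) with h1 | h1
      · left
        rw [min_eq_left h1] at ht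
        linarith
      · right
        rw [min_eq_right h1] at ht
        linarith
    · left
      rw [hzero h0, h0, Real.log_zero]
      linarith
    · left
      have := Real.log_le_log h0 hle
      linarith

theorem ae_exists_return_to_ball {M : Type*} [MeasurableSpace M] {ν : Measure M}
    [IsProbabilityMeasure ν] {Ψ : ℝ → M → M} (hadd : ∀ s t x, Ψ (s + t) x = Ψ s (Ψ t x))
    (hinv : ∀ t, MeasurePreserving (Ψ t) ν ν) {N : ℕ} {f : M → EuclideanSpace ℝ (Fin N)}
    (hf : Measurable f) {S : Set ℝ} (hS : ∀ n : ℕ, ∃ σ : ℝ, ∀ j : ℕ, 1 ≤ j → j ≤ n → j * σ ∈ S) :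
    ∀ᵐ x ∂ν, ∀ r > 0, ∃ t ∈ S, f (Ψ t x) ∈ ball (f x) r := by
  have h : ∀ᵐ x ∂ν, ∀ k : ℕ, ∀ a : Fin N → ℤ,
      x ∈ (gridIndex (1 / ((k : ℝ) + 1) / (N + 1)) ∘ f) ⁻¹' {a} →
      ∃ t ∈ S, Ψ t x ∈ (gridIndex (1 / ((k : ℝ) + 1) / (N + 1)) ∘ f) ⁻¹' {a} :=
    ae_all_iff.2 fun k => ae_all_iff.2 fun a => ae_exists_return_mem hadd hinv
      (((measurable_gridIndex _).comp hf) (measurableSet_singleton a)) hS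
  filter_upwards [h] with x hx r hr
  obtain ⟨k, hk⟩ := exists_nat_one_div_lt hr
  obtain ⟨t, ht, htx⟩ := hx k _ rfl
  exact ⟨t, ht, (dist_lt_of_gridIndex_eq (by positivity) htx).trans hk⟩

/-- **Theorem 2.4.** For a measurable flow `Ψ` preserving a probability measure `ν`, a
measurable observation `f : M → ℝ^N` and an escape function `ρ`, for ν-a.e. `x`,
the lower (resp. upper) recurrence rate for the observation is bounded above by the
liminf (resp. limsup) of `log f⋆ν(B(f x, r))/log r − log ρ_r(f x)/log r`. -/
theorem obs_recurrence_rate_upper_bound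
    {M : Type*} [MetricSpace M] [MeasurableSpace M] {N : ℕ}
    (Ψ : ℝ → M → M) (hΨ0 : ∀ x, Ψ 0 x = x) (hΨadd : ∀ s t x, Ψ (s + t) x = Ψ s (Ψ t x))
    (hΨmeas : Measurable fun p : ℝ × M => Ψ p.1 p.2)
    (ν : Measure M) [IsProbabilityMeasure ν]
    (hinv : ∀ t, MeasurePreserving (Ψ t) ν ν)
    (f : M → EuclideanSpace ℝ (Fin N)) (hf : Measurable f)
    (ρ : ℝ → EuclideanSpace ℝ (Fin N) → ℝ) (hρ : IsEscapeFunction (ν.map f) ρ) :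
    ∀ᵐ x ∂ν,
      (liminf (fun r : ℝ => Real.log (obsReturnTime Ψ f ρ r x) / (-Real.log r)) (𝓝[>] 0)
        ≤ liminf (fun r : ℝ =>
            Real.log ((ν.map f) (ball (f x) r)).toReal / Real.log r
              - Real.log (ρ r (f x)) / Real.log r) (𝓝[>] 0)) ∧
      (limsup (fun r : ℝ => Real.log (obsReturnTime Ψ f ρ r x) / (-Real.log r)) (𝓝[>] 0)
        ≤ limsup (fun r : ℝ =>
            Real.log ((ν.map f) (ball (f x) r)).toReal / Real.log r
              - Real.log (ρ r (f x)) / Real.log r) (𝓝[>] 0)) := by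
  have : IsProbabilityMeasure (ν.map f) := Measure.isProbabilityMeasure_map hf.aemeasurable
  have hsmall : ∀ δ : ℝ, 0 < δ → ∀ n : ℕ, ∃ σ : ℝ, ∀ j : ℕ, 1 ≤ j → j ≤ n →
      0 < j * σ ∧ j * σ < δ := by
    intro δ hδ n
    refine ⟨δ / (n + 1), fun j h1 h2 => ⟨by positivity, ?_⟩⟩
    have h3 : (j : ℝ) < n + 1 := by exact_mod_cast Nat.lt_succ_of_le h2
    rw [← mul_div_assoc, div_lt_iff₀ (by positivity), mul_comm]
    gcongr
  have htop : ∀ᵐ x ∂ν, ∀ p : ℕ, ∀ r > 0, ∃ t ∈ Set.Ioi (p : ℝ), f (Ψ t x) ∈ ball (f x) r := by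
    refine ae_all_iff.2 fun p => ae_exists_return_to_ball hΨadd hinv hf fun n =>
      ⟨p + 1, fun j h1 _ => ?_⟩
    have h3 : (1 : ℝ) ≤ j := by exact_mod_cast h1
    exact (lt_add_one _).trans_le (le_mul_of_one_le_left (by positivity) h3)
  have hpos : ∀ᵐ x ∂ν, ∀ p : ℕ, ∀ r > 0,
      ∃ t ∈ Set.Ioo (0 : ℝ) (1 / ((p : ℝ) + 1)), f (Ψ t x) ∈ ball (f x) r :=
    ae_all_iff.2 fun p => ae_exists_return_to_ball hΨadd hinv hf (hsmall _ (by positivity))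
  have hneg : ∀ᵐ x ∂ν, ∀ p : ℕ, ∀ r > 0,
      ∃ t ∈ Set.Ioo (-(1 / ((p : ℝ) + 1))) (0 : ℝ), f (Ψ t x) ∈ ball (f x) r := by
    refine ae_all_iff.2 fun p => ae_exists_return_to_ball hΨadd hinv hf fun n => ?_
    obtain ⟨σ, hσ⟩ := hsmall (1 / ((p : ℝ) + 1)) (by positivity) n
    refine ⟨-σ, fun j h1 h2 => ?_⟩
    rw [mul_neg]
    exact ⟨neg_lt_neg (hσ j h1 h2).2, neg_lt_zero.2 (hσ j h1 h2).1⟩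
  filter_upwards [htop, hpos, hneg, ae_eventually_return_to_ball hΨadd hinv hf,
    ae_of_ae_map hf.aemeasurable (ae_eventually_pow_le_measure_ball (ν.map f))]
    with x hxtop hxpos hxneg hxret hxlow
  have hβ1 : ∀ r, (ν.map f).real (ball (f x) r) ≤ 1 := fun r => measureReal_le_one
  have hV : Monotone fun r : ℝ => {t : ℝ | f (Ψ t x) ∈ ball (f x) r} :=
    fun r s hrs t ht => ball_subset_ball hrs ht
  refine liminf_limsup_log_sInf_le (β := fun r => (ν.map f).real (ball (f x) r))
    (ρ := fun r => ρ r (f x)) (V := fun r => {t | f (Ψ t x) ∈ ball (f x) r}) hβ1 hxlow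
    ?_ ?_ ?_ fun C hC ε hε => eventually_exists_mem_windows
      (fun r s hrs => measureReal_mono (ball_subset_ball hrs))
      hV hβ1 hxlow hxret hC hε
  · intro r hr s
    obtain ⟨p, hp⟩ := exists_nat_ge s
    obtain ⟨t, ht, htx⟩ := hxtop p r hr
    exact ⟨t, htx, hp.trans_lt ht⟩
  · intro r hr δ hδ
    obtain ⟨p, hp⟩ := exists_nat_one_div_lt hδ
    obtain ⟨t, ht, htx⟩ := hxpos p r hr
    exact ⟨t, htx, ht.1, ht.2.trans hp⟩
  · intro r hr δ hδ
    obtain ⟨p, hp⟩ := exists_nat_one_div_lt hδ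
    obtain ⟨t, ht, htx⟩ := hxneg p r hr
    exact ⟨t, htx, (neg_lt_neg hp).trans ht.1, ht.2⟩
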